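/- Let m be a positive integer and L, M, N ⊆ [m] with M ≠ [m] and N ≠ [m]. Let D = (1+u^2)Δ_L + u^2(Δ_M^c + (u+u^2)Δ_N^c) ⊆ R^m. Then C_D has length |D| = (2^m − 2^{|M|})(2^m − 2^{|N|})·2^{|L|} and |C_D| = 2^{2m+|L|}; in particular the number of v ∈ R^m with wt_L(c_D(v)) = 0 (equivalently, the size of the kernel of c_D) is 2^{m−|L|}. -/

import Mathlib

open Polynomial
open scoped Classical

noncomputable section

/-- The ring `R = Z₂[u]/⟨u³ - u⟩`. -/
abbrev Rng : Type := AdjoinRoot (X ^ 3 - X : Polynomial (ZMod 2))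

/-- The image `u` of the variable in `R`. -/
def u : Rng := AdjoinRoot.root (X ^ 3 - X : Polynomial (ZMod 2))

/-- The natural inclusion of `Z₂` into `R`. -/
def toRng : ZMod 2 →+* Rng := AdjoinRoot.of _

lemma cubic_monic : (X ^ 3 - X : Polynomial (ZMod 2)).Monic :=
  Polynomial.monic_X_pow_sub (n := 3) (Polynomial.degree_X_le.trans_lt (by norm_num))

/-- The Gray map `Φ : R → Z₂³`, `Φ(a + u b + u² d) = (a + b, b + d, d)`:
every element of `R` is represented by a unique polynomial of degree `< 3`,
whose coefficients are `a, b, d`. -/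
def Phi (r : Rng) : Fin 3 → ZMod 2 :=
  ![(AdjoinRoot.modByMonicHom cubic_monic r).coeff 0 +
      (AdjoinRoot.modByMonicHom cubic_monic r).coeff 1,
    (AdjoinRoot.modByMonicHom cubic_monic r).coeff 1 +
      (AdjoinRoot.modByMonicHom cubic_monic r).coeff 2,
    (AdjoinRoot.modByMonicHom cubic_monic r).coeff 2]

/-- The support of a vector in `Z₂^m`. -/
def supp {m : ℕ} (v : Fin m → ZMod 2) : Finset (Fin m) :=
  Finset.univ.filter (fun i => v i = 1)

/-- The simplicial complex `Δ_X` generated by `X ⊆ [m]`. -/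
def Δ {m : ℕ} (X : Finset (Fin m)) : Finset (Fin m → ZMod 2) :=
  Finset.univ.filter (fun v => supp v ⊆ X)

/-- The Lee weight of a tuple over `R`: the Hamming weight of its coordinatewise Gray image. -/
def wtL {ι : Type} [Fintype ι] (x : ι → Rng) : ℕ :=
  ∑ i, (Finset.univ.filter (fun j : Fin 3 => Phi (x i) j ≠ 0)).card

/-- The defining set `D = (1+u²)D₁ + u²(D₂ + (u+u²)D₃) ⊆ R^m`. -/
def Dset {m : ℕ} (D1 D2 D3 : Finset (Fin m → ZMod 2)) : Finset (Fin m → Rng) :=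
  ((D1 ×ˢ D2) ×ˢ D3).image (fun t i =>
    (1 + u ^ 2) * toRng (t.1.1 i) +
      u ^ 2 * (toRng (t.1.2 i) + (u + u ^ 2) * toRng (t.2 i)))

/-- The codeword `c_D(v) = (v ⬝ d)_{d ∈ D}` of `C_D`. -/
def cD {m : ℕ} (D : Finset (Fin m → Rng)) (v : Fin m → Rng) : D → Rng :=
  fun d => ∑ i, v i * d.1 i


/-- Elements of `R` in the coordinates `(1+u²)a + u²b + (u+u²)c`. -/
def FF (a b c : ZMod 2) : Rng :=
  (1 + u ^ 2) * toRng a + u ^ 2 * toRng b + (u + u ^ 2) * toRng c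

lemma u_cube : u ^ 3 = u := by
  have h : AdjoinRoot.mk (X ^ 3 - X : Polynomial (ZMod 2)) (X ^ 3 - X) = 0 := AdjoinRoot.mk_self
  rw [map_sub, map_pow, AdjoinRoot.mk_X] at h
  exact sub_eq_zero.mp h

lemma rng_two : (2 : Rng) = 0 := by
  have h : toRng 2 = 0 := by
    rw [show (2 : ZMod 2) = 0 from rfl, map_zero]
  rw [← h]
  exact (map_ofNat toRng 2).symm

lemma FF_mul (a b c a' b' c' : ZMod 2) :
    FF a b c * FF a' b' c' = FF (a * a') (b * b') (b * c' + c * b') := by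
  unfold FF
  simp only [map_mul, map_add]
  generalize toRng a = x
  generalize toRng b = y
  generalize toRng c = z
  generalize toRng a' = x'
  generalize toRng b' = y'
  generalize toRng c' = z'
  have h := u_cube
  have h2 := rng_two
  grind

lemma FF_sum {ι : Type} (s : Finset ι) (a b c : ι → ZMod 2) :
    ∑ i ∈ s, FF (a i) (b i) (c i) = FF (∑ i ∈ s, a i) (∑ i ∈ s, b i) (∑ i ∈ s, c i) := by
  unfold FF
  simp only [Finset.sum_add_distrib, map_sum, Finset.mul_sum]

lemma poly_deg (x y z : ZMod 2) :
    (C x + C y * X + C z * X ^ 2 : Polynomial (ZMod 2)).degree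
      < (X ^ 3 - X : Polynomial (ZMod 2)).degree := by
  have h : (X ^ 3 - X : Polynomial (ZMod 2)).degree = 3 := by
    compute_degree!
  rw [h]
  refine lt_of_le_of_lt (b := 2) ?_ (by norm_num)
  compute_degree

lemma mod_mk (x y z : ZMod 2) :
    AdjoinRoot.modByMonicHom cubic_monic
      (AdjoinRoot.mk (X ^ 3 - X : Polynomial (ZMod 2)) (C x + C y * X + C z * X ^ 2))
      = C x + C y * X + C z * X ^ 2 := by
  rw [AdjoinRoot.modByMonicHom_mk, (Polynomial.modByMonic_eq_self_iff cubic_monic).2 (poly_deg x y z)]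

lemma FF_eq_mk (a b c : ZMod 2) :
    FF a b c = AdjoinRoot.mk (X ^ 3 - X : Polynomial (ZMod 2))
      (C a + C c * X + C (a + b + c) * X ^ 2) := by
  simp only [map_add, map_mul, map_pow, AdjoinRoot.mk_X, AdjoinRoot.mk_C]
  unfold FF toRng u
  ring

lemma coeffs (x y z : ZMod 2) :
    (C x + C y * X + C z * X ^ 2 : Polynomial (ZMod 2)).coeff 0 = x ∧
    (C x + C y * X + C z * X ^ 2 : Polynomial (ZMod 2)).coeff 1 = y ∧
    (C x + C y * X + C z * X ^ 2 : Polynomial (ZMod 2)).coeff 2 = z := by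
  refine ⟨?_, ?_, ?_⟩ <;> simp [coeff_X, coeff_C, coeff_X_pow]

lemma FF_inj {a b c a' b' c' : ZMod 2} (h : FF a b c = FF a' b' c') :
    a = a' ∧ b = b' ∧ c = c' := by
  rw [FF_eq_mk, FF_eq_mk] at h
  have h' := congrArg (AdjoinRoot.modByMonicHom cubic_monic) h
  rw [mod_mk, mod_mk] at h'
  have h0 := congrArg (fun p => p.coeff 0) h'
  have h1 := congrArg (fun p => p.coeff 1) h'
  have h2 := congrArg (fun p => p.coeff 2) h'
  simp only [(coeffs _ _ _).1, (coeffs _ _ _).2.1, (coeffs _ _ _).2.2] at h0 h1 h2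
  subst h0 h1
  simpa using h2

lemma FF_zero : FF 0 0 0 = 0 := by simp [FF]

lemma FF_surj (r : Rng) : ∃ a b c, r = FF a b c := by
  obtain ⟨p, rfl⟩ := AdjoinRoot.mk_surjective r
  have hm := AdjoinRoot.mk_leftInverse cubic_monic (AdjoinRoot.mk _ p)
  rw [AdjoinRoot.modByMonicHom_mk] at hm
  set q := p %ₘ (X ^ 3 - X : Polynomial (ZMod 2)) with hq
  have hd : q.natDegree < 3 := by
    have h3 : (X ^ 3 - X : Polynomial (ZMod 2)).natDegree = 3 := by compute_degree!
    rw [← h3]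
    apply Polynomial.natDegree_modByMonic_lt _ cubic_monic
    intro h1
    rw [h1] at h3
    simp at h3
  have hs := q.as_sum_range' 3 hd
  simp only [Finset.sum_range_succ, Finset.sum_range_zero, zero_add,
    ← C_mul_X_pow_eq_monomial, pow_zero, mul_one, pow_one] at hs
  refine ⟨q.coeff 0, q.coeff 0 + q.coeff 1 + q.coeff 2, q.coeff 1, ?_⟩
  rw [FF_eq_mk, ← hm]
  have : ∀ x y z : ZMod 2, x + (x + y + z) + y = z := by decide
  rw [this, ← hs]

lemma Phi_eq_zero (r : Rng) : (∀ j, Phi r j = 0) ↔ r = 0 := by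
  obtain ⟨a, b, c, rfl⟩ := FF_surj r
  constructor
  · intro h
    have h0 := h 0
    have h1 := h 1
    have h2 := h 2
    unfold Phi at h0 h1 h2
    rw [FF_eq_mk, mod_mk] at h0 h1 h2
    rw [(coeffs _ _ _).1, (coeffs _ _ _).2.1, (coeffs _ _ _).2.2] at h0 h1 h2
    have key : ∀ a b c : ZMod 2, a + c = 0 → c + (a + b + c) = 0 → a + b + c = 0 →
      a = 0 ∧ b = 0 ∧ c = 0 := by decide
    obtain ⟨rfl, rfl, rfl⟩ := key a b c h0 h1 h2
    exact FF_zero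
  · intro h j
    rw [h]
    unfold Phi
    fin_cases j <;> simp

lemma wtL_eq_zero {ι : Type} [Fintype ι] (x : ι → Rng) : wtL x = 0 ↔ x = 0 := by
  unfold wtL
  rw [Finset.sum_eq_zero_iff, funext_iff]
  refine forall_congr' fun i => ?_
  simp only [Finset.mem_univ, true_imp_iff, Finset.card_eq_zero, Finset.filter_eq_empty_iff,
    not_not]
  exact Phi_eq_zero (x i)

lemma zmod2_cases (x : ZMod 2) : x = 0 ∨ x = 1 := by
  revert x; decide

lemma mem_Δ {m : ℕ} (X : Finset (Fin m)) (v : Fin m → ZMod 2) :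
    v ∈ Δ X ↔ ∀ i, i ∉ X → v i = 0 := by
  simp only [Δ, supp, Finset.mem_filter, Finset.mem_univ, true_and, Finset.subset_iff]
  refine forall_congr' fun i => ?_
  rcases zmod2_cases (v i) with h | h <;> simp [h]

lemma card_Δ {m : ℕ} (X : Finset (Fin m)) : (Δ X).card = 2 ^ X.card := by
  rw [← Finset.card_powerset]
  refine Finset.card_nbij' supp (fun s i => if i ∈ s then 1 else 0) ?_ ?_ ?_ ?_
  · intro v hv
    simpa [Δ] using hv
  · intro s hs
    simp only [Finset.coe_powerset, Set.mem_preimage, Set.mem_powerset_iff, Finset.coe_subset] at hs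
    rw [Finset.mem_coe, mem_Δ]
    intro i hi
    exact if_neg (fun h => hi (hs h))
  · intro v _
    funext i
    rcases zmod2_cases (v i) with h | h <;> simp [supp, h]
  · intro s _
    ext i
    simp [supp]

lemma card_Δ_compl {m : ℕ} (X : Finset (Fin m)) :
    (((Δ X)ᶜ).card : ℤ) = 2 ^ m - 2 ^ X.card := by
  rw [Finset.card_compl, Nat.cast_sub (Finset.card_le_univ _), card_Δ]
  simp [ZMod.card]

lemma exists_mem_compl {m : ℕ} (M : Finset (Fin m)) (hM : M ≠ Finset.univ) :
    ∃ t, t ∈ (Δ M)ᶜ := by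
  obtain ⟨j, hj⟩ : ∃ j, j ∉ M := by
    by_contra! h
    exact hM (Finset.eq_univ_iff_forall.2 h)
  refine ⟨Pi.single j 1, ?_⟩
  rw [Finset.mem_compl, mem_Δ]
  intro h
  simpa using h j hj

lemma compl_span {m : ℕ} (M : Finset (Fin m)) (hM : M ≠ Finset.univ) (b : Fin m → ZMod 2)
    (hb : ∀ t ∈ (Δ M)ᶜ, ∑ i, b i * t i = 0) : b = 0 := by
  obtain ⟨j, hj⟩ : ∃ j, j ∉ M := by
    by_contra! h
    exact hM (Finset.eq_univ_iff_forall.2 h)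
  have h1 : b j = 0 := by
    have := hb (Pi.single j 1) (by
      rw [Finset.mem_compl, mem_Δ]
      intro h
      simpa using h j hj)
    simpa [Pi.single_apply] using this
  funext i
  by_cases hij : i = j
  · rw [hij, h1]; rfl
  · have := hb (Pi.single j 1 + Pi.single i 1) (by
      rw [Finset.mem_compl, mem_Δ]
      intro h
      have := h j hj
      simp [Pi.single_apply, Ne.symm hij] at this)
    simpa [Pi.single_apply, mul_add, Finset.sum_add_distrib, h1] using this

lemma Dset_fun {m : ℕ} (t : ((Fin m → ZMod 2) × (Fin m → ZMod 2)) × (Fin m → ZMod 2)) (i : Fin m) :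
    (1 + u ^ 2) * toRng (t.1.1 i) +
      u ^ 2 * (toRng (t.1.2 i) + (u + u ^ 2) * toRng (t.2 i))
      = FF (t.1.1 i) (t.1.2 i) (t.2 i) := by
  unfold FF
  have h := u_cube
  grind

lemma Dset_eq {m : ℕ} (D1 D2 D3 : Finset (Fin m → ZMod 2)) :
    Dset D1 D2 D3 = ((D1 ×ˢ D2) ×ˢ D3).image
      (fun t i => FF (t.1.1 i) (t.1.2 i) (t.2 i)) := by
  unfold Dset
  simp only [Dset_fun]

lemma card_Dset {m : ℕ} (D1 D2 D3 : Finset (Fin m → ZMod 2)) :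
    (Dset D1 D2 D3).card = D1.card * D2.card * D3.card := by
  rw [Dset_eq, Finset.card_image_of_injective, Finset.card_product, Finset.card_product]
  rintro ⟨⟨a, b⟩, c⟩ ⟨⟨a', b'⟩, c'⟩ h
  have h' := fun i => FF_inj (congrFun h i)
  simp only [Prod.mk.injEq]
  exact ⟨⟨funext fun i => (h' i).1, funext fun i => (h' i).2.1⟩, funext fun i => (h' i).2.2⟩

lemma cD_eq_zero {m : ℕ} (D1 D2 D3 : Finset (Fin m → ZMod 2)) (a b c : Fin m → ZMod 2) :
    cD (Dset D1 D2 D3) (fun i => FF (a i) (b i) (c i)) = 0 ↔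
      ∀ t1 ∈ D1, ∀ t2 ∈ D2, ∀ t3 ∈ D3, ∑ i, a i * t1 i = 0 ∧ ∑ i, b i * t2 i = 0 ∧
        ∑ i, (b i * t3 i + c i * t2 i) = 0 := by
  constructor
  · intro h t1 h1 t2 h2 t3 h3
    have hmem : (fun i => FF (t1 i) (t2 i) (t3 i)) ∈ Dset D1 D2 D3 := by
      rw [Dset_eq, Finset.mem_image]
      exact ⟨((t1, t2), t3), by simp [h1, h2, h3], rfl⟩
    have h0 := congrFun h ⟨_, hmem⟩
    simp only [cD, FF_mul, FF_sum, Pi.zero_apply] at h0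
    rw [← FF_zero] at h0
    exact FF_inj h0
  · intro h
    funext ⟨d, hd⟩
    have hd' := hd
    rw [Dset_eq, Finset.mem_image] at hd'
    obtain ⟨⟨⟨t1, t2⟩, t3⟩, ht, rfl⟩ := hd'
    simp only [Finset.mem_product] at ht
    obtain ⟨h1, h2, h3⟩ := h t1 ht.1.1 t2 ht.1.2 t3 ht.2
    simp only [cD, FF_mul, FF_sum, Pi.zero_apply]
    rw [h1, h2, h3, FF_zero]

lemma ker_eq {m : ℕ} (L M N : Finset (Fin m))
    (hM : M ≠ Finset.univ) (hN : N ≠ Finset.univ) :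
    {v : Fin m → Rng | cD (Dset (Δ L) ((Δ M)ᶜ) ((Δ N)ᶜ)) v = 0} =
      (fun (a : Fin m → ZMod 2) i => FF (a i) 0 0) '' (Δ Lᶜ : Set (Fin m → ZMod 2)) := by
  ext v
  simp only [Set.mem_setOf_eq, Set.mem_image, Finset.mem_coe]
  constructor
  · intro h
    choose a b c hv using fun i => FF_surj (v i)
    obtain rfl : v = fun i => FF (a i) (b i) (c i) := funext hv
    rw [cD_eq_zero] at h
    obtain ⟨s2, hs2⟩ := exists_mem_compl M hM
    obtain ⟨s3, hs3⟩ := exists_mem_compl N hN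
    have h0 : (0 : Fin m → ZMod 2) ∈ Δ L := by rw [mem_Δ]; intro i _; rfl
    have hb : b = 0 := compl_span M hM b fun t ht => (h 0 h0 t ht s3 hs3).2.1
    have hc : c = 0 := compl_span M hM c fun t ht => by
      simpa [hb] using (h 0 h0 t ht s3 hs3).2.2
    subst hb hc
    refine ⟨a, ?_, rfl⟩
    rw [mem_Δ]
    intro i hi
    have hi : i ∈ L := by simpa using hi
    have := (h (Pi.single i 1) (by
      rw [mem_Δ]
      intro k hk
      rw [Pi.single_apply, if_neg]
      rintro rfl
      exact hk hi) s2 hs2 s3 hs3).1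
    simpa [Pi.single_apply] using this
  · rintro ⟨a, ha, rfl⟩
    rw [mem_Δ] at ha
    refine (cD_eq_zero _ _ _ a 0 0).2 ?_
    intro t1 h1 t2 _ t3 _
    rw [mem_Δ] at h1
    refine ⟨Finset.sum_eq_zero fun i _ => ?_, by simp, by simp⟩
    by_cases hi : i ∈ L
    · rw [ha i (by simpa using hi), zero_mul]
    · rw [h1 i hi, mul_zero]

lemma card_ker {m : ℕ} (L M N : Finset (Fin m))
    (hM : M ≠ Finset.univ) (hN : N ≠ Finset.univ) :
    Nat.card {v : Fin m → Rng | cD (Dset (Δ L) ((Δ M)ᶜ) ((Δ N)ᶜ)) v = 0} =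
      2 ^ (m - L.card) := by
  rw [ker_eq L M N hM hN, Nat.card_image_of_injective]
  · rw [Nat.card_eq_fintype_card]
    simp only [Finset.coe_sort_coe, Fintype.card_coe]
    rw [card_Δ, Finset.card_compl, Fintype.card_fin]
  · intro a a' h
    exact funext fun i => (FF_inj (congrFun h i)).1

lemma card_Rng : Nat.card Rng = 8 := by
  have h : Function.Bijective (fun t : ZMod 2 × ZMod 2 × ZMod 2 => FF t.1 t.2.1 t.2.2) := by
    constructor
    · rintro ⟨a, b, c⟩ ⟨a', b', c'⟩ h
      obtain ⟨rfl, rfl, rfl⟩ := FF_inj h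
      rfl
    · intro r
      obtain ⟨a, b, c, rfl⟩ := FF_surj r
      exact ⟨(a, b, c), rfl⟩
  rw [← Nat.card_eq_of_bijective _ h]
  simp [Nat.card_prod]

/-- `cD` as an additive homomorphism. -/
def cDhom {m : ℕ} (D : Finset (Fin m → Rng)) : (Fin m → Rng) →+ (D → Rng) where
  toFun := cD D
  map_zero' := by funext d; simp [cD]
  map_add' := by intro v w; funext d; simp [cD, add_mul, Finset.sum_add_distrib]

lemma card_range_mul {m : ℕ} (D : Finset (Fin m → Rng)) :
    Nat.card (Set.range (cD D)) * Nat.card {v : Fin m → Rng | cD D v = 0} = 8 ^ m := by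
  have h := AddSubgroup.card_eq_card_quotient_mul_card_addSubgroup (cDhom D).ker
  rw [Nat.card_congr (QuotientAddGroup.quotientKerEquivRange (cDhom D)).toEquiv] at h
  rw [Nat.card_fun, card_Rng, Nat.card_fin] at h
  exact h.symm

theorem code_LMcNc (m : ℕ) (hm : 0 < m) (L M N : Finset (Fin m))
    (hM : M ≠ Finset.univ) (hN : N ≠ Finset.univ)
    (D : Finset (Fin m → Rng)) (hD : D = Dset (Δ L) ((Δ M)ᶜ) ((Δ N)ᶜ)) :
    ((D.card : ℤ) = (2 ^ m - 2 ^ M.card) * (2 ^ m - 2 ^ N.card) * 2 ^ L.card) ∧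
    Nat.card (Set.range (cD D)) = 2 ^ (2 * m + L.card) ∧
    Nat.card {v : Fin m → Rng | wtL (cD D v) = 0} = 2 ^ (m - L.card) ∧
    Nat.card {v : Fin m → Rng | cD D v = 0} = 2 ^ (m - L.card) := by
  subst hD
  have hk := card_ker L M N hM hN
  refine ⟨?_, ?_, ?_, hk⟩
  · rw [card_Dset]
    push_cast
    rw [card_Δ_compl, card_Δ_compl, card_Δ]
    push_cast
    ring
  · have h := card_range_mul (Dset (Δ L) ((Δ M)ᶜ) ((Δ N)ᶜ))
    rw [hk] at h
    have hL : L.card ≤ m := by simpa using Finset.card_le_univ L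
    apply Nat.eq_of_mul_eq_mul_right (pow_pos (by norm_num : 0 < 2) (m - L.card))
    rw [h, ← pow_add, show (8 : ℕ) = 2 ^ 3 by norm_num, ← pow_mul]
    congr 1
    omega
  · simp only [wtL_eq_zero]
    exact hk

end
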